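/- Let a C¹-spacetime on ℝⁿ be causally non-branching and non-intertwining. If γ₁, γ₂ : [0,1] → ℝⁿ are causal geodesics with γ₁(0) = γ₂(0) = p and γ̇₁(0) = γ̇₂(0) = v, then γ₁(t) = γ₂(t) for all t ∈ [0,1]. -/

import Mathlib

open Set Filter Topology MeasureTheory
open scoped ENNReal NNReal

noncomputable section

/-- Points of ℝⁿ. -/
abbrev SpacetimePt (n : ℕ) := Fin n → ℝ

/-- Evaluation of a bilinear form given by a coefficient matrix. -/
def bilForm {n : ℕ} (g : Fin n → Fin n → ℝ) (u v : Fin n → ℝ) : ℝ :=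
  ∑ i, ∑ j, g i j * u i * v j

/-- The Minkowski matrix diag(−1,1,…,1). -/
def minkowskiMatrix (n : ℕ) : Fin n → Fin n → ℝ := fun i j =>
  if i = j then (if (i : ℕ) = 0 then -1 else 1) else 0

/-- A time-oriented C¹-spacetime on ℝⁿ: a C¹ family of symmetric bilinear forms of
Lorentzian signature (−,+,…,+), together with a continuous timelike vector field. -/
structure C1Spacetime (n : ℕ) where
  g : SpacetimePt n → Fin n → Fin n → ℝ
  g_contDiff : ContDiff ℝ 1 g
  g_symm : ∀ p i j, g p i j = g p j i
  g_lorentz : ∀ p : SpacetimePt n, ∃ L : (Fin n → ℝ) ≃ₗ[ℝ] (Fin n → ℝ),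
    ∀ i j, bilForm (g p) (L (Pi.single i 1)) (L (Pi.single j 1)) = minkowskiMatrix n i j
  X0 : SpacetimePt n → Fin n → ℝ
  X0_cont : Continuous X0
  X0_timelike : ∀ p, bilForm (g p) (X0 p) (X0 p) < 0

namespace C1Spacetime

variable {n : ℕ} (M : C1Spacetime n)

/-- The inverse metric. -/
def ginv (p : SpacetimePt n) : Matrix (Fin n) (Fin n) ℝ :=
  (Matrix.of (M.g p))⁻¹

/-- Christoffel symbols Γᵏᵢⱼ = ½ Σ_l gᵏˡ(∂ᵢ g_{jl} + ∂ⱼ g_{il} − ∂_l g_{ij}). -/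
def christoffel (k i j : Fin n) (p : SpacetimePt n) : ℝ :=
  (1 / 2) * ∑ l, M.ginv p k l *
    (fderiv ℝ (fun q => M.g q j l) p (Pi.single i 1)
      + fderiv ℝ (fun q => M.g q i l) p (Pi.single j 1)
      - fderiv ℝ (fun q => M.g q i j) p (Pi.single l 1))

/-- A geodesic on the interval `I` : a C² curve satisfying the geodesic equation. -/
def IsGeodesicOn (γ : ℝ → SpacetimePt n) (I : Set ℝ) : Prop :=
  ContDiffOn ℝ 2 γ I ∧ ∀ t ∈ I, ∀ k,
    derivWithin (fun s => derivWithin γ I s k) I t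
      + ∑ i, ∑ j, M.christoffel k i j (γ t) *
          derivWithin γ I t i * derivWithin γ I t j = 0

/-- `v` is a causal vector at `p`. -/
def CausalVec (p v : SpacetimePt n) : Prop := v ≠ 0 ∧ bilForm (M.g p) v v ≤ 0

/-- `v` is a timelike vector at `p`. -/
def TimelikeVec (p v : SpacetimePt n) : Prop := bilForm (M.g p) v v < 0

/-- A causal vector `v` at `p` is future-directed. -/
def FdVec (p v : SpacetimePt n) : Prop := bilForm (M.g p) v (M.X0 p) < 0

/-- A causal vector `v` at `p` is past-directed. -/
def PdVec (p v : SpacetimePt n) : Prop := 0 < bilForm (M.g p) v (M.X0 p)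

/-- A causal geodesic on `I`: the velocity is everywhere causal. -/
def IsCausalGeodesicOn (γ : ℝ → SpacetimePt n) (I : Set ℝ) : Prop :=
  M.IsGeodesicOn γ I ∧ ∀ t ∈ I, M.CausalVec (γ t) (derivWithin γ I t)

/-- A future-directed causal geodesic on `I`. -/
def IsFdCausalGeodesicOn (γ : ℝ → SpacetimePt n) (I : Set ℝ) : Prop :=
  M.IsGeodesicOn γ I ∧ ∀ t ∈ I,
    M.CausalVec (γ t) (derivWithin γ I t) ∧ M.FdVec (γ t) (derivWithin γ I t)

/-- A past-directed causal geodesic on `I`. -/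
def IsPdCausalGeodesicOn (γ : ℝ → SpacetimePt n) (I : Set ℝ) : Prop :=
  M.IsGeodesicOn γ I ∧ ∀ t ∈ I,
    M.CausalVec (γ t) (derivWithin γ I t) ∧ M.PdVec (γ t) (derivWithin γ I t)

/-- A geodesic `γ : [a,b] → ℝⁿ` branches at `t₀ ∈ (a,b)`. -/
def BranchesAt (γ : ℝ → SpacetimePt n) (a b t₀ : ℝ) : Prop :=
  ∃ ε > 0, a ≤ t₀ - ε ∧ t₀ + ε ≤ b ∧
    ∃ σ : ℝ → SpacetimePt n, M.IsGeodesicOn σ (Ioo (t₀ - ε) (t₀ + ε)) ∧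
      (∀ t ∈ Ioc (t₀ - ε) t₀, γ t = σ t) ∧
      (γ '' Ioo t₀ (t₀ + ε)) ∩ (σ '' Ioo t₀ (t₀ + ε)) = ∅

/-- No causal geodesic branches. -/
def CausallyNonBranching : Prop :=
  ∀ (γ : ℝ → SpacetimePt n) (a b : ℝ), a < b → M.IsCausalGeodesicOn γ (Icc a b) →
    ∀ t₀ ∈ Ioo a b, ¬ M.BranchesAt γ a b t₀

/-- Non-intertwining. -/
def NonIntertwining : Prop :=
  ∀ p : SpacetimePt n, ∃ U ∈ 𝓝 p, ∀ ε : ℝ, 0 < ε → ∀ γ₁ γ₂ : ℝ → SpacetimePt n,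
    M.IsCausalGeodesicOn γ₁ (Icc 0 ε) → M.IsCausalGeodesicOn γ₂ (Icc 0 ε) →
    (∀ t ∈ Icc (0:ℝ) ε, γ₁ t ∈ U) → (∀ t ∈ Icc (0:ℝ) ε, γ₂ t ∈ U) →
    γ₁ 0 = p → γ₂ 0 = p →
    derivWithin γ₁ (Icc 0 ε) 0 = derivWithin γ₂ (Icc 0 ε) 0 →
    (∀ t ∈ Icc (0:ℝ) ε, γ₁ t = γ₂ t) ∨
      ¬ ∃ z : SpacetimePt n, AccPt z (𝓟 ((γ₁ '' Ioc 0 ε) ∩ (γ₂ '' Ioc 0 ε)))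

/-- Domain of the causal exponential map at `p`. -/
def ExpDomain (p : SpacetimePt n) : Set (SpacetimePt n) :=
  {v | bilForm (M.g p) v v ≤ 0 ∧
    ∃ γ : ℝ → SpacetimePt n, M.IsCausalGeodesicOn γ (Icc 0 1) ∧ γ 0 = p ∧
      derivWithin γ (Icc 0 1) 0 = v}

/-- A future-directed causal path on the interval `I`: locally Lipschitz with almost
everywhere future-directed causal derivative. -/
def IsFdCausalPathOn (γ : ℝ → SpacetimePt n) (I : Set ℝ) : Prop :=
  I.OrdConnected ∧ I.Nonempty ∧
    (∀ t ∈ I, ∃ K : ℝ≥0, ∃ U ∈ 𝓝[I] t, LipschitzOnWith K γ U) ∧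
    ∀ᵐ t ∂(volume.restrict I), DifferentiableAt ℝ γ t ∧
      M.CausalVec (γ t) (deriv γ t) ∧ M.FdVec (γ t) (deriv γ t)

/-- A future-directed timelike path on the interval `I`. -/
def IsFdTimelikePathOn (γ : ℝ → SpacetimePt n) (I : Set ℝ) : Prop :=
  I.OrdConnected ∧ I.Nonempty ∧
    (∀ t ∈ I, ∃ K : ℝ≥0, ∃ U ∈ 𝓝[I] t, LipschitzOnWith K γ U) ∧
    ∀ᵐ t ∂(volume.restrict I), DifferentiableAt ℝ γ t ∧
      M.TimelikeVec (γ t) (deriv γ t) ∧ M.FdVec (γ t) (deriv γ t)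

/-- Chronological relation `p ≪ q`. -/
def chron (p q : SpacetimePt n) : Prop :=
  ∃ (γ : ℝ → SpacetimePt n) (a b : ℝ), a < b ∧ M.IsFdTimelikePathOn γ (Icc a b) ∧
    γ a = p ∧ γ b = q

/-- Causal relation `p ≤ q`. -/
def causalLe (p q : SpacetimePt n) : Prop :=
  p = q ∨ ∃ (γ : ℝ → SpacetimePt n) (a b : ℝ), a < b ∧ M.IsFdCausalPathOn γ (Icc a b) ∧
    γ a = p ∧ γ b = q

/-- g-length of a causal path on `[a,b]`. -/
def gLength (γ : ℝ → SpacetimePt n) (a b : ℝ) : ℝ :=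
  ∫ t in a..b, Real.sqrt (- bilForm (M.g (γ t)) (deriv γ t) (deriv γ t))

/-- Lorentzian distance. -/
def ldist (p q : SpacetimePt n) : ℝ≥0∞ :=
  ⨆ (γ : ℝ → SpacetimePt n) (a : ℝ) (b : ℝ) (_ : a < b)
    (_ : M.IsFdCausalPathOn γ (Icc a b)) (_ : γ a = p) (_ : γ b = q),
    ENNReal.ofReal (M.gLength γ a b)

/-- Non-total imprisonment: no future or past inextendible causal curve is contained
in a compact set (inextendible = no limit at the open end). -/
def NonImprisoning : Prop :=
  ∀ K : Set (SpacetimePt n), IsCompact K →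
    (∀ (a b : ℝ) (γ : ℝ → SpacetimePt n), M.IsFdCausalPathOn γ (Ico a b) →
      (¬ ∃ q, Tendsto γ (𝓝[<] b) (𝓝 q)) → ¬ ∀ t ∈ Ico a b, γ t ∈ K) ∧
    (∀ (a : ℝ) (γ : ℝ → SpacetimePt n), M.IsFdCausalPathOn γ (Ici a) →
      (¬ ∃ q, Tendsto γ atTop (𝓝 q)) → ¬ ∀ t ∈ Ici a, γ t ∈ K) ∧
    (∀ (a b : ℝ) (γ : ℝ → SpacetimePt n), M.IsFdCausalPathOn γ (Ioc a b) →
      (¬ ∃ q, Tendsto γ (𝓝[>] a) (𝓝 q)) → ¬ ∀ t ∈ Ioc a b, γ t ∈ K) ∧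
    (∀ (b : ℝ) (γ : ℝ → SpacetimePt n), M.IsFdCausalPathOn γ (Iic b) →
      (¬ ∃ q, Tendsto γ atBot (𝓝 q)) → ¬ ∀ t ∈ Iic b, γ t ∈ K)

/-- Global hyperbolicity. -/
def GloballyHyperbolic : Prop :=
  M.NonImprisoning ∧
    ∀ p q : SpacetimePt n, IsCompact {z : SpacetimePt n | M.causalLe p z ∧ M.causalLe z q}

/-- Finite compactness. -/
def FinitelyCompact : Prop :=
  ∀ B : ℝ, 0 < B → ∀ p q : SpacetimePt n, ∀ x : ℕ → SpacetimePt n,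
    ((∀ m, M.chron p q ∧ M.causalLe q (x m) ∧ M.ldist p (x m) ≤ ENNReal.ofReal B) →
      ∃ z : SpacetimePt n, MapClusterPt z atTop x) ∧
    ((∀ m, M.causalLe (x m) q ∧ M.chron q p ∧ M.ldist (x m) p ≤ ENNReal.ofReal B) →
      ∃ z : SpacetimePt n, MapClusterPt z atTop x)

/-- Timelike Cauchy completeness. -/
def TimelikeCauchyComplete : Prop :=
  ∀ (x : ℕ → SpacetimePt n) (B : ℕ → ℝ), (∀ m, 0 ≤ B m) → Tendsto B atTop (𝓝 0) →
    (((∀ m, M.chron (x m) (x (m + 1))) ∧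
        ∀ k m : ℕ, 0 < m → M.ldist (x k) (x (k + m)) ≤ ENNReal.ofReal (B k)) ∨
      ((∀ m, M.chron (x (m + 1)) (x m)) ∧
        ∀ k m : ℕ, 0 < m → M.ldist (x (k + m)) (x k) ≤ ENNReal.ofReal (B k))) →
    ∃ l : SpacetimePt n, Tendsto x atTop (𝓝 l)

/-- Condition A for C¹-spacetimes: for `x ≪ y` and every future inextendible
future-directed causal geodesic starting at `y` defined on `[0,c)` (`c ∈ (0,∞]`),
the Lorentzian distance `T(x, γ(t))` tends to infinity as `t → c`; dually for the past. -/
def ConditionA : Prop :=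
  (∀ x y : SpacetimePt n, M.chron x y →
    (∀ c : ℝ, 0 < c → ∀ γ : ℝ → SpacetimePt n, M.IsFdCausalGeodesicOn γ (Ico 0 c) →
      γ 0 = y → (¬ ∃ z, Tendsto γ (𝓝[<] c) (𝓝 z)) →
      Tendsto (fun t => M.ldist x (γ t)) (𝓝[<] c) (𝓝 ⊤)) ∧
    (∀ γ : ℝ → SpacetimePt n, M.IsFdCausalGeodesicOn γ (Ici 0) →
      γ 0 = y → (¬ ∃ z, Tendsto γ atTop (𝓝 z)) →
      Tendsto (fun t => M.ldist x (γ t)) atTop (𝓝 ⊤))) ∧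
  (∀ x y : SpacetimePt n, M.chron y x →
    (∀ c : ℝ, 0 < c → ∀ γ : ℝ → SpacetimePt n, M.IsPdCausalGeodesicOn γ (Ico 0 c) →
      γ 0 = y → (¬ ∃ z, Tendsto γ (𝓝[<] c) (𝓝 z)) →
      Tendsto (fun t => M.ldist (γ t) x) (𝓝[<] c) (𝓝 ⊤)) ∧
    (∀ γ : ℝ → SpacetimePt n, M.IsPdCausalGeodesicOn γ (Ici 0) →
      γ 0 = y → (¬ ∃ z, Tendsto γ atTop (𝓝 z)) →
      Tendsto (fun t => M.ldist (γ t) x) atTop (𝓝 ⊤)))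

end C1Spacetime

/-- The Euler polygon with step `h` starting at `x₀`, sampled at its vertices. -/
def eulerSeq {E : Type*} [NormedAddCommGroup E] [NormedSpace ℝ E] (F : E → E) (h : ℝ) (x₀ : E)
    (j : ℕ) : E :=
  (fun y => y + h • F y)^[j] x₀

section Peano

variable {E : Type*} [NormedAddCommGroup E] [NormedSpace ℝ E]

lemma eulerSeq_succ (F : E → E) (h : ℝ) (x₀ : E) (j : ℕ) :
    eulerSeq F h x₀ (j + 1) = eulerSeq F h x₀ j + h • F (eulerSeq F h x₀ j) := by
  simp only [eulerSeq, Function.iterate_succ_apply']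

lemma eulerSeq_sub_sub_smul_norm_le {F : E → E} {h : ℝ} (hh : 0 ≤ h) (x₀ w : E) {c : ℝ}
    {i j : ℕ} (hij : i ≤ j)
    (hF : ∀ m, i ≤ m → m < j → ‖F (eulerSeq F h x₀ m) - w‖ ≤ c) :
    ‖eulerSeq F h x₀ j - eulerSeq F h x₀ i - ((j * h - i * h) • w)‖ ≤ c * (j * h - i * h) := by
  induction j, hij using Nat.le_induction with
  | base => simp
  | succ j hij ih =>
    have h1 := ih fun m hm hmj => hF m hm (by omega)
    have h2 := hF j hij (by omega)
    have h3 : eulerSeq F h x₀ (j + 1) - eulerSeq F h x₀ i - (((j + 1 : ℕ) * h - i * h) • w)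
        = (eulerSeq F h x₀ j - eulerSeq F h x₀ i - ((j * h - i * h) • w))
          + h • (F (eulerSeq F h x₀ j) - w) := by
      rw [eulerSeq_succ]; push_cast; module
    rw [h3]
    refine (norm_add_le _ _).trans ?_
    rw [norm_smul, Real.norm_of_nonneg hh]
    push_cast
    nlinarith [mul_le_mul_of_nonneg_left h2 hh]

lemma eulerSeq_dist_le {F : E → E} {C : ℝ} (hF : ∀ y, ‖F y‖ ≤ C) {h : ℝ} (hh : 0 ≤ h) (x₀ : E)
    (i j : ℕ) : ‖eulerSeq F h x₀ j - eulerSeq F h x₀ i‖ ≤ C * |j * h - i * h| := by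
  wlog hij : i ≤ j generalizing i j
  · rw [norm_sub_rev, abs_sub_comm]; exact this j i (by omega)
  have h1 := eulerSeq_sub_sub_smul_norm_le (F := F) hh x₀ 0 (c := C) hij
    fun m _ _ => by simpa using hF _
  have h2 : (0 : ℝ) ≤ j * h - i * h := by
    have : (i : ℝ) ≤ j := by exact_mod_cast hij
    nlinarith
  rw [abs_of_nonneg h2]
  simpa using h1

/-- Peano's theorem for a bounded continuous vector field: existence of a forward solution. -/
theorem exists_forward_solution_of_bounded [ProperSpace E] {F : E → E} (hFc : Continuous F) {C : ℝ}
    (hF : ∀ y, ‖F y‖ ≤ C) (x₀ : E) :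
    ∃ x : ℝ → E, x 0 = x₀ ∧ ∀ t ∈ Ici (0 : ℝ), HasDerivWithinAt x (F (x t)) (Ici 0) t := by
  have hC : 0 ≤ C := (norm_nonneg _).trans (hF x₀)
  set h : ℕ → ℝ := fun k => 1 / ((k : ℝ) + 1) with hh
  have hpos : ∀ k, 0 < h k := fun k => by positivity
  have hlim : Tendsto h atTop (𝓝 0) := tendsto_one_div_add_atTop_nhds_zero_nat
  set N : ℝ → ℕ → ℕ := fun t k => ⌊t * ((k : ℝ) + 1)⌋₊ with hN
  have hNle : ∀ t, 0 ≤ t → ∀ k, N t k * h k ≤ t := fun t ht k => by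
    have := Nat.floor_le (a := t * ((k : ℝ) + 1)) (by positivity)
    simp only [hh, hN, mul_one_div]
    rw [div_le_iff₀ (by positivity)]; exact this
  have hNge : ∀ t k, t - h k ≤ N t k * h k := fun t k => by
    have := (Nat.lt_floor_add_one (t * ((k : ℝ) + 1))).le
    simp only [hh, hN, mul_one_div]
    rw [sub_le_iff_le_add, ← add_div, le_div_iff₀ (by positivity)]; exact this
  have hNlim : ∀ t, 0 ≤ t → Tendsto (fun k => (N t k : ℝ) * h k) atTop (𝓝 t) := fun t ht =>
    tendsto_of_tendsto_of_tendsto_of_le_of_le (by simpa using tendsto_const_nhds.sub hlim)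
      tendsto_const_nhds (hNge t) (hNle t ht)
  set u : ℝ → ℕ → E := fun t k => eulerSeq F (h k) x₀ (N t k) with hu
  have hU : ((hyperfilter ℕ : Ultrafilter ℕ) : Filter ℕ) ≤ atTop := Nat.hyperfilter_le_atTop
  have hex : ∀ t : ℝ, ∃ z, 0 ≤ t → Tendsto (u t) (hyperfilter ℕ) (𝓝 z) := fun t => by
    by_cases ht : 0 ≤ t
    · obtain ⟨z, -, hz⟩ := (isCompact_closedBall x₀ (C * t)).ultrafilter_le_nhds
        ((hyperfilter ℕ).map (u t)) (by
          rw [le_principal_iff, Ultrafilter.coe_map, mem_map]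
          refine Filter.mem_of_superset univ_mem fun k _ => ?_
          have h1 := eulerSeq_dist_le hF (hpos k).le x₀ 0 (N t k)
          have h2 : |((N t k : ℕ) : ℝ) * h k - (0 : ℕ) * h k| ≤ t := by
            have := (hpos k).le
            rw [Nat.cast_zero, zero_mul, sub_zero, abs_of_nonneg (by positivity)]
            exact hNle t ht k
          exact mem_closedBall_iff_norm.2 (h1.trans (mul_le_mul_of_nonneg_left h2 hC)))
      exact ⟨z, fun _ => hz⟩
    · exact ⟨x₀, fun h => absurd h ht⟩
  choose x hx using hex
  have key : ∀ t₀, 0 ≤ t₀ → ∀ c > 0, ∃ r > 0, ∀ s t, 0 ≤ s → s ≤ t → |s - t₀| ≤ r →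
      |t - t₀| ≤ r → ‖x t - x s - (t - s) • F (x t₀)‖ ≤ c * (t - s) := by
    intro t₀ ht₀ c hc
    obtain ⟨ρ, hρ, hρF⟩ := Metric.continuousAt_iff.1 (hFc.continuousAt (x := x t₀)) c hc
    refine ⟨ρ / (2 * (C + 1)), by positivity, fun s t hs hst hsr htr => ?_⟩
    set r := ρ / (2 * (C + 1)) with hr
    have hCr : C * r < ρ := by
      rw [hr, mul_div_assoc', div_lt_iff₀ (by positivity)]
      nlinarith
    have hev : ∀ᶠ k in (hyperfilter ℕ : Filter ℕ), C * (r + h k) + ‖u t₀ k - x t₀‖ < ρ := by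
      have h1 : Tendsto (fun k => C * (r + h k) + ‖u t₀ k - x t₀‖) (hyperfilter ℕ)
          (𝓝 (C * (r + 0) + ‖x t₀ - x t₀‖)) :=
        ((tendsto_const_nhds.add (hlim.mono_left hU)).const_mul C).add
          ((hx t₀ ht₀).sub_const _).norm
      refine h1.eventually_lt_const (by simpa using hCr)
    have hb : ∀ᶠ k in (hyperfilter ℕ : Filter ℕ),
        ‖u t k - u s k - ((N t k * h k - N s k * h k) • F (x t₀))‖
          ≤ c * (N t k * h k - N s k * h k) := by
      filter_upwards [hev] with k hk
      refine eulerSeq_sub_sub_smul_norm_le (hpos k).le x₀ _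
        (Nat.floor_le_floor (by have := hst; gcongr)) fun m hm hmt => ?_
      rw [← dist_eq_norm]
      refine (hρF ?_).le
      rw [dist_eq_norm]
      refine lt_of_le_of_lt (norm_sub_le_norm_sub_add_norm_sub _ (u t₀ k) _) (lt_of_le_of_lt ?_ hk)
      gcongr
      refine (eulerSeq_dist_le hF (hpos k).le x₀ _ _).trans ?_
      gcongr
      have e1 : (N s k : ℝ) * h k ≤ m * h k :=
        mul_le_mul_of_nonneg_right (by exact_mod_cast hm) (hpos k).le
      have e2 : (m : ℝ) * h k ≤ N t k * h k :=
        mul_le_mul_of_nonneg_right (by exact_mod_cast hmt.le) (hpos k).le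
      have e3 := hNle t (hs.trans hst) k
      have e4 := hNge s k
      have e5 := hNle t₀ ht₀ k
      have e6 := hNge t₀ k
      rw [abs_le] at hsr htr ⊢
      constructor <;> linarith [hpos k]
    have hd : Tendsto (fun k => (N t k * h k - N s k * h k : ℝ)) (hyperfilter ℕ) (𝓝 (t - s)) :=
      ((hNlim t (hs.trans hst)).sub (hNlim s hs)).mono_left hU
    exact le_of_tendsto_of_tendsto
      (((hx t (hs.trans hst)).sub (hx s hs)).sub (hd.smul_const _)).norm
      (hd.const_mul c) hb
  refine ⟨x, ?_, fun t₀ ht₀ => ?_⟩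
  · refine tendsto_nhds_unique (hx 0 le_rfl) ?_
    simp [hu, hN, eulerSeq]
  · rw [hasDerivWithinAt_iff_isLittleO, Asymptotics.isLittleO_iff]
    intro c hc
    obtain ⟨r, hr, hk⟩ := key t₀ ht₀ c hc
    filter_upwards [self_mem_nhdsWithin,
      mem_nhdsWithin_of_mem_nhds (Metric.closedBall_mem_nhds t₀ hr)]
      with t ht htr
    rw [Metric.mem_closedBall, Real.dist_eq] at htr
    rcases le_total t₀ t with h1 | h1
    · have := hk t₀ t ht₀ h1 (by simpa using hr.le) htr
      rwa [Real.norm_of_nonneg (sub_nonneg.2 h1)]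
    · have := hk t t₀ ht h1 htr (by simpa using hr.le)
      rw [Real.norm_of_nonpos (sub_nonpos.2 h1), neg_sub, ← norm_neg]
      rwa [show -(x t - x t₀ - (t - t₀) • F (x t₀)) = x t₀ - x t - (t₀ - t) • F (x t₀) by module]

/-- Peano's theorem for a continuous vector field: existence of a local backward solution. -/
theorem exists_backward_solution [ProperSpace E] {f : E → E} (hf : Continuous f) (x₀ : E) :
    ∃ x : ℝ → E, x 0 = x₀ ∧ ∃ δ > 0, ∀ t ∈ Icc (-δ) 0,
      HasDerivWithinAt x (f (x t)) (Icc (-δ) 0) t := by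
  set φ : E → ℝ := fun y => max 0 (min 1 (2 - ‖y - x₀‖)) with hφ
  have hφc : Continuous φ := by fun_prop
  obtain ⟨C, hC⟩ := (isCompact_closedBall x₀ 2).exists_bound_of_continuousOn hf.continuousOn
  have hC0 : 0 ≤ C := (norm_nonneg _).trans (hC x₀ (by simp))
  have hb : ∀ y, ‖-(φ y • f y)‖ ≤ C := fun y => by
    have h0 : 0 ≤ φ y := le_max_left _ _
    have h1 : φ y ≤ 1 := max_le zero_le_one (min_le_left _ _)
    rw [norm_neg, norm_smul, Real.norm_of_nonneg h0]
    by_cases hy : ‖y - x₀‖ ≤ 2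
    · have := hC y (mem_closedBall_iff_norm.2 hy)
      nlinarith [norm_nonneg (f y)]
    · have : φ y = 0 := max_eq_left ((min_le_right _ _).trans (by linarith))
      simpa [this] using hC0
  obtain ⟨x, hx0, hx⟩ := exists_forward_solution_of_bounded (hφc.smul hf).neg hb x₀
  have hev : ∀ᶠ t in 𝓝[≥] (0 : ℝ), ‖x t - x₀‖ < 1 := by
    have h1 : Tendsto (fun t => ‖x t - x₀‖) (𝓝[≥] 0) (𝓝 ‖x 0 - x₀‖) :=
      ((hx 0 self_mem_Ici).continuousWithinAt.sub continuousWithinAt_const).norm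
    exact h1.eventually_lt_const (by simp [hx0])
  obtain ⟨δ, hδ, hδx⟩ := mem_nhdsGE_iff_exists_Icc_subset.1 hev
  refine ⟨fun t => x (-t), by simpa using hx0, δ, hδ, fun t ht => ?_⟩
  have ht' : -t ∈ Icc 0 δ := ⟨by linarith [ht.2], by linarith [ht.1]⟩
  have h1 : φ (x (-t)) = 1 := by
    have : ‖x (-t) - x₀‖ < 1 := hδx ht'
    simp only [hφ]
    rw [min_eq_left (by linarith), max_eq_right zero_le_one]
  have h2 := (hx (-t) ht'.1).scomp t ((hasDerivAt_neg t).hasDerivWithinAt (s := Icc (-δ) 0))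
    fun s hs => by simpa using hs.2
  simpa [h1, Function.comp_def] using h2

end Peano

namespace C1Spacetime

variable {n : ℕ} (M : C1Spacetime n)

lemma det_g_ne_zero (p : SpacetimePt n) : (Matrix.of (M.g p)).det ≠ 0 := by
  obtain ⟨L, hL⟩ := M.g_lorentz p
  intro h0
  set P : Matrix (Fin n) (Fin n) ℝ := Matrix.of fun k i => L (Pi.single i 1) k with hP
  have h1 : P.transpose * Matrix.of (M.g p) * P
      = Matrix.diagonal fun i : Fin n => if (i : ℕ) = 0 then (-1 : ℝ) else 1 := by
    ext i j
    have h2 := hL i j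
    simp only [bilForm, minkowskiMatrix] at h2
    rw [Matrix.diagonal_apply, ← h2]
    simp only [Matrix.mul_apply, Matrix.transpose_apply, Finset.sum_mul, hP, Matrix.of_apply]
    rw [Finset.sum_comm]
    exact Finset.sum_congr rfl fun a _ => Finset.sum_congr rfl fun b _ => by ring
  have h2 := congrArg Matrix.det h1
  rw [Matrix.det_mul, Matrix.det_mul, h0, Matrix.det_diagonal, mul_zero, zero_mul] at h2
  obtain ⟨i, -, hi⟩ := Finset.prod_eq_zero_iff.1 h2.symm
  split_ifs at hi <;> norm_num at hi

lemma contDiff_g_apply (i j : Fin n) : ContDiff ℝ 1 fun q => M.g q i j :=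
  contDiff_pi.1 (contDiff_pi.1 M.g_contDiff i) j

lemma continuous_ginv : Continuous M.ginv := by
  have h1 : Continuous fun p => Matrix.of (M.g p) := M.g_contDiff.continuous
  unfold ginv
  simp only [Matrix.inv_def, Ring.inverse_eq_inv']
  exact (h1.matrix_det.inv₀ M.det_g_ne_zero).smul h1.matrix_adjugate

lemma continuous_christoffel (k i j : Fin n) : Continuous (M.christoffel k i j) := by
  have hD : ∀ a b c : Fin n, Continuous fun p =>
      fderiv ℝ (fun q => M.g q a b) p (Pi.single c 1) := fun a b c =>
    ((M.contDiff_g_apply a b).continuous_fderiv one_ne_zero).clm_apply continuous_const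
  have hG : ∀ l, Continuous fun p => M.ginv p k l := fun l => M.continuous_ginv.matrix_elem k l
  unfold christoffel
  exact continuous_const.mul <| continuous_finsetSum _ fun l _ =>
    (hG l).mul (((hD j l i).add (hD i l j)).sub (hD i j l))

/-- The geodesic spray on `ℝⁿ × ℝⁿ`. -/
def spray (z : SpacetimePt n × SpacetimePt n) : SpacetimePt n × SpacetimePt n :=
  (z.2, fun k => -∑ i, ∑ j, M.christoffel k i j z.1 * z.2 i * z.2 j)

lemma continuous_spray : Continuous M.spray := by
  have := M.continuous_christoffel
  unfold spray
  fun_prop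

/-- `z` is an integral curve of the geodesic spray on `I`. -/
def IsSprayCurveOn (z : ℝ → SpacetimePt n × SpacetimePt n) (I : Set ℝ) : Prop :=
  ∀ t ∈ I, HasDerivWithinAt z (M.spray (z t)) I t

/-- `z` is an integral curve of the geodesic spray on `I` through causal vectors. -/
def IsCausalSprayCurveOn (z : ℝ → SpacetimePt n × SpacetimePt n) (I : Set ℝ) : Prop :=
  M.IsSprayCurveOn z I ∧ ∀ t ∈ I, M.CausalVec (z t).1 (z t).2

variable {M} {z : ℝ → SpacetimePt n × SpacetimePt n} {I J : Set ℝ}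

lemma IsSprayCurveOn.hasDerivWithinAt_fst (hz : M.IsSprayCurveOn z I) {t : ℝ} (ht : t ∈ I) :
    HasDerivWithinAt (fun s => (z s).1) (z t).2 I t :=
  (hz t ht).fst

lemma IsSprayCurveOn.hasDerivWithinAt_snd (hz : M.IsSprayCurveOn z I) {t : ℝ} (ht : t ∈ I) :
    HasDerivWithinAt (fun s => (z s).2) (M.spray (z t)).2 I t :=
  (hz t ht).snd

lemma IsSprayCurveOn.continuousOn (hz : M.IsSprayCurveOn z I) : ContinuousOn z I :=
  fun t ht => (hz t ht).continuousWithinAt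

lemma IsSprayCurveOn.mono (hz : M.IsSprayCurveOn z I) (h : J ⊆ I) : M.IsSprayCurveOn z J :=
  fun t ht => (hz t (h ht)).mono h

lemma IsCausalSprayCurveOn.mono (hz : M.IsCausalSprayCurveOn z I) (h : J ⊆ I) :
    M.IsCausalSprayCurveOn z J :=
  ⟨hz.1.mono h, fun t ht => hz.2 t (h ht)⟩

lemma IsSprayCurveOn.derivWithin_fst (hz : M.IsSprayCurveOn z I) (hI : UniqueDiffOn ℝ I) {t : ℝ}
    (ht : t ∈ I) : derivWithin (fun s => (z s).1) I t = (z t).2 :=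
  (hz.hasDerivWithinAt_fst ht).derivWithin (hI t ht)

lemma IsSprayCurveOn.isGeodesicOn (hz : M.IsSprayCurveOn z I) (hI : UniqueDiffOn ℝ I) :
    M.IsGeodesicOn (fun t => (z t).1) I := by
  have hd : EqOn (derivWithin (fun s => (z s).1) I) (fun t => (z t).2) I :=
    fun t ht => hz.derivWithin_fst hI ht
  have hd2 : EqOn (derivWithin (fun s => (z s).2) I) (fun t => (M.spray (z t)).2) I :=
    fun t ht => (hz.hasDerivWithinAt_snd ht).derivWithin (hI t ht)
  constructor
  · rw [show (2 : WithTop ℕ∞) = 1 + 1 by norm_num, contDiffOn_succ_iff_derivWithin hI]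
    refine ⟨fun t ht => (hz.hasDerivWithinAt_fst ht).differentiableWithinAt, by simp, ?_⟩
    refine ContDiffOn.congr ?_ hd
    rw [show (1 : WithTop ℕ∞) = 0 + 1 by norm_num, contDiffOn_succ_iff_derivWithin hI]
    refine ⟨fun t ht => (hz.hasDerivWithinAt_snd ht).differentiableWithinAt, by simp, ?_⟩
    rw [contDiffOn_zero]
    exact ((M.continuous_spray.comp_continuousOn hz.continuousOn).snd).congr hd2
  · intro t ht k
    have h1 : derivWithin (fun s => derivWithin (fun s => (z s).1) I s k) I t
        = (M.spray (z t)).2 k := by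
      rw [derivWithin_congr (f := fun s => (z s).2 k) (fun s hs => by rw [hd hs])
        (by rw [hd ht])]
      exact (hasDerivWithinAt_pi.1 (hz.hasDerivWithinAt_snd ht) k).derivWithin (hI t ht)
    rw [h1, hd ht]
    simp [spray]

lemma IsGeodesicOn.isSprayCurveOn {γ : ℝ → SpacetimePt n} (h : M.IsGeodesicOn γ I)
    (hI : UniqueDiffOn ℝ I) : M.IsSprayCurveOn (fun t => (γ t, derivWithin γ I t)) I := by
  obtain ⟨hc, hg⟩ := h
  rw [show (2 : WithTop ℕ∞) = 1 + 1 by norm_num, contDiffOn_succ_iff_derivWithin hI] at hc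
  intro t ht
  refine (hc.1 t ht).hasDerivWithinAt.prodMk (hasDerivWithinAt_pi.2 fun k => ?_)
  have h1 : DifferentiableWithinAt ℝ (fun s => derivWithin γ I s k) I t :=
    differentiableWithinAt_pi.1 (hc.2.2.differentiableOn one_ne_zero t ht) k
  have h2 := h1.hasDerivWithinAt
  rwa [eq_neg_of_add_eq_zero_left (hg t ht k)] at h2

lemma IsCausalGeodesicOn.isCausalSprayCurveOn {γ : ℝ → SpacetimePt n}
    (h : M.IsCausalGeodesicOn γ I) (hI : UniqueDiffOn ℝ I) :
    M.IsCausalSprayCurveOn (fun t => (γ t, derivWithin γ I t)) I :=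
  ⟨h.1.isSprayCurveOn hI, h.2⟩

lemma IsCausalSprayCurveOn.isCausalGeodesicOn (hz : M.IsCausalSprayCurveOn z I)
    (hI : UniqueDiffOn ℝ I) : M.IsCausalGeodesicOn (fun t => (z t).1) I :=
  ⟨hz.1.isGeodesicOn hI, fun t ht => by rw [hz.1.derivWithin_fst hI ht]; exact hz.2 t ht⟩

lemma IsSprayCurveOn.comp_const_add (hz : M.IsSprayCurveOn z I) (s : ℝ) :
    M.IsSprayCurveOn (fun t => z (s + t)) ((fun t => s + t) ⁻¹' I) := fun t ht => by
  have h1 := (hz (s + t) ht).scomp t ((hasDerivAt_id t).const_add s).hasDerivWithinAt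
    (mapsTo_preimage (fun t => s + t) I)
  simpa [Function.comp_def] using h1

/-- Joining two integral curves of the spray that agree at time `0`. -/
lemma IsSprayCurveOn.join {α β : ℝ → SpacetimePt n × SpacetimePt n} {a b : ℝ}
    (hα : M.IsSprayCurveOn α (Icc a 0)) (hβ : M.IsSprayCurveOn β (Icc 0 b)) (h0 : α 0 = β 0)
    (ha : a ≤ 0) (hb : 0 ≤ b) :
    M.IsSprayCurveOn (fun t => if t ≤ 0 then α t else β t) (Icc a b) := by
  set ζ : ℝ → SpacetimePt n × SpacetimePt n := fun t => if t ≤ 0 then α t else β t with hζ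
  have eα : ∀ t ≤ 0, ζ t = α t := fun t ht => if_pos ht
  have eβ : ∀ t, 0 ≤ t → ζ t = β t := fun t ht => by
    rcases ht.eq_or_lt with rfl | ht
    · rw [eα 0 le_rfl, h0]
    · exact if_neg ht.not_ge
  have hα' : M.IsSprayCurveOn ζ (Icc a 0) := fun t ht => by
    rw [eα t ht.2]
    exact (hα t ht).congr (fun s hs => eα s hs.2) (eα t ht.2)
  have hβ' : M.IsSprayCurveOn ζ (Icc 0 b) := fun t ht => by
    rw [eβ t ht.1]
    exact (hβ t ht).congr (fun s hs => eβ s hs.1) (eβ t ht.1)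
  intro t ht
  rw [← Icc_union_Icc_eq_Icc ha hb]
  rcases lt_trichotomy t 0 with h | rfl | h
  · exact (hα' t ⟨ht.1, h.le⟩).union (HasFDerivWithinAt.of_notMem_closure (by simp [h]))
  · exact (hα' 0 ⟨ha, le_rfl⟩).union (hβ' 0 ⟨le_rfl, hb⟩)
  · exact HasDerivWithinAt.union (HasFDerivWithinAt.of_notMem_closure (by simp [h]))
      (hβ' t ⟨h.le, ht.2⟩)

lemma g_mulVec_spray_snd (x w : SpacetimePt n) (m : Fin n) :
    ∑ k, M.g x m k * (M.spray (x, w)).2 k = -(1 / 2) * ∑ a, ∑ b,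
      (fderiv ℝ (fun q => M.g q b m) x (Pi.single a 1)
        + fderiv ℝ (fun q => M.g q a m) x (Pi.single b 1)
        - fderiv ℝ (fun q => M.g q a b) x (Pi.single m 1)) * w a * w b := by
  set c : Fin n → ℝ := fun l => ∑ a, ∑ b,
      (fderiv ℝ (fun q => M.g q b l) x (Pi.single a 1)
        + fderiv ℝ (fun q => M.g q a l) x (Pi.single b 1)
        - fderiv ℝ (fun q => M.g q a b) x (Pi.single l 1)) * w a * w b with hc
  have h1 : (M.spray (x, w)).2 = (-(1 / 2) : ℝ) • (M.ginv x).mulVec c := by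
    ext k
    simp only [spray, christoffel, Matrix.mulVec, dotProduct, Pi.smul_apply, smul_eq_mul, hc,
      Finset.mul_sum, Finset.sum_mul, ← Finset.sum_neg_distrib]
    rw [Finset.sum_congr rfl fun i _ => Finset.sum_comm, Finset.sum_comm]
    refine Finset.sum_congr rfl fun l _ => Finset.sum_congr rfl fun a _ =>
      Finset.sum_congr rfl fun b _ => ?_
    ring
  have h2 : (Matrix.of (M.g x)).mulVec (M.spray (x, w)).2 = (-(1 / 2) : ℝ) • c := by
    rw [h1, Matrix.mulVec_smul, Matrix.mulVec_mulVec, ginv,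
      Matrix.mul_nonsing_inv _ (isUnit_iff_ne_zero.2 (M.det_g_ne_zero x)), Matrix.one_mulVec]
  exact congrFun h2 m

/-- The squared norm of the velocity is conserved along the geodesic spray. -/
lemma IsSprayCurveOn.hasDerivWithinAt_bilForm (hz : M.IsSprayCurveOn z I) {t : ℝ} (ht : t ∈ I) :
    HasDerivWithinAt (fun s => bilForm (M.g (z s).1) (z s).2 (z s).2) 0 I t := by
  rcases hzt : z t with ⟨x, w⟩
  set A := (M.spray (x, w)).2 with hA
  have hx := hz.hasDerivWithinAt_fst ht
  have hw := hasDerivWithinAt_pi.1 (hz.hasDerivWithinAt_snd ht)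
  have hgd : ∀ i j, HasDerivWithinAt (fun s => M.g (z s).1 i j)
      (fderiv ℝ (fun q => M.g q i j) x w) I t := fun i j => by
    have h1 := (((M.contDiff_g_apply i j).differentiable one_ne_zero) (z t).1).hasFDerivAt
    have h2 := h1.comp_hasDerivWithinAt t hx
    rw [hzt] at h2
    exact h2
  have h1 : HasDerivWithinAt (fun s => bilForm (M.g (z s).1) (z s).2 (z s).2)
      (∑ i, ∑ j, ((fderiv ℝ (fun q => M.g q i j) x w * w i + M.g x i j * A i) * w j
        + M.g x i j * w i * A j)) I t := by
    have h2 := HasDerivWithinAt.fun_sum fun i (_ : i ∈ Finset.univ) =>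
      HasDerivWithinAt.fun_sum fun j (_ : j ∈ Finset.univ) =>
        ((hgd i j).mul (hw i)).mul (hw j)
    simp only [hzt, Pi.mul_apply] at h2
    exact h2
  convert h1 using 1
  set D : Fin n → Fin n → Fin n → ℝ := fun l i j =>
    fderiv ℝ (fun q => M.g q i j) x (Pi.single l 1) with hD
  have hDsymm : ∀ l i j, D l i j = D l j i := fun l i j => by
    simp only [hD, fun q => M.g_symm q i j]
  have hsum : ∀ i j, fderiv ℝ (fun q => M.g q i j) x w = ∑ l, w l * D l i j := fun i j => by
    conv_lhs => rw [pi_eq_sum_univ' w]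
    simp [map_sum, hD]
  set S := ∑ a, ∑ b, ∑ c, D a b c * w a * w b * w c with hS
  have e1 : ∑ i, ∑ j, fderiv ℝ (fun q => M.g q i j) x w * w i * w j = S := by
    simp only [hsum, Finset.sum_mul, hS]
    rw [Finset.sum_congr rfl fun i _ => Finset.sum_comm, Finset.sum_comm]
    exact Finset.sum_congr rfl fun a _ => Finset.sum_congr rfl fun b _ =>
      Finset.sum_congr rfl fun c _ => by ring
  have e2 : ∑ m, w m * ∑ k, M.g x m k * A k = -(1 / 2) * S := by
    have s1 : ∑ m, ∑ a, ∑ b, D a b m * w a * w b * w m = S := by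
      rw [Finset.sum_comm]
      exact Finset.sum_congr rfl fun a _ => Finset.sum_comm
    have s2 : ∑ m, ∑ a, ∑ b, D b a m * w a * w b * w m = S := by
      rw [← s1]
      refine Finset.sum_congr rfl fun m _ => ?_
      rw [Finset.sum_comm]
      exact Finset.sum_congr rfl fun a _ => Finset.sum_congr rfl fun b _ => by ring
    have s3 : ∑ m, ∑ a, ∑ b, D m a b * w a * w b * w m = S :=
      Finset.sum_congr rfl fun a _ => Finset.sum_congr rfl fun b _ =>
        Finset.sum_congr rfl fun c _ => by ring
    have s4 : ∑ m, w m * ∑ k, M.g x m k * A k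
        = -(1 / 2) * (∑ m, ∑ a, ∑ b, D a b m * w a * w b * w m
          + ∑ m, ∑ a, ∑ b, D b a m * w a * w b * w m
          - ∑ m, ∑ a, ∑ b, D m a b * w a * w b * w m) := by
      simp only [hA, g_mulVec_spray_snd, ← Finset.sum_add_distrib, ← Finset.sum_sub_distrib,
        Finset.mul_sum]
      exact Finset.sum_congr rfl fun a _ => Finset.sum_congr rfl fun b _ =>
        Finset.sum_congr rfl fun c _ => by ring
    rw [s4, s1, s2, s3]; ring
  have e3 : ∑ i, ∑ j, M.g x i j * w i * A j = -(1 / 2) * S := by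
    rw [← e2]
    simp only [Finset.mul_sum]
    exact Finset.sum_congr rfl fun a _ => Finset.sum_congr rfl fun b _ => by ring
  have e4 : ∑ i, ∑ j, M.g x i j * A i * w j = -(1 / 2) * S := by
    rw [← e3, Finset.sum_comm]
    exact Finset.sum_congr rfl fun a _ => Finset.sum_congr rfl fun b _ => by
      rw [M.g_symm x b a]; ring
  simp only [add_mul, Finset.sum_add_distrib]
  rw [e1, e3, e4]; ring

variable (M) in
/-- A causal vector is the final velocity of a causal geodesic defined on some `[-δ, 0]`. -/
lemma exists_backward_causalSprayCurve (z₀ : SpacetimePt n × SpacetimePt n)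
    (h₀ : M.CausalVec z₀.1 z₀.2) :
    ∃ α : ℝ → SpacetimePt n × SpacetimePt n, α 0 = z₀ ∧
      ∃ δ > 0, M.IsCausalSprayCurveOn α (Icc (-δ) 0) := by
  obtain ⟨α, hα0, δ, hδ, hα⟩ := exists_backward_solution M.continuous_spray z₀
  replace hα : M.IsSprayCurveOn α (Icc (-δ) 0) := hα
  have hev : ∀ᶠ t in 𝓝[≤] (0 : ℝ), (α t).2 ≠ 0 := by
    have h1 : ContinuousWithinAt (fun t => (α t).2) (Icc (-δ) 0) 0 :=
      (hα 0 ⟨by linarith, le_rfl⟩).continuousWithinAt.snd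
    rw [ContinuousWithinAt, nhdsWithin_Icc_eq_nhdsLE (by linarith)] at h1
    exact h1.eventually_ne (by rw [hα0]; exact h₀.1)
  obtain ⟨c, hc, hcα⟩ := mem_nhdsLE_iff_exists_Icc_subset.1 hev
  have hc0 : c < 0 := hc
  set d := min δ (-c) with hd
  have hd0 : 0 < d := lt_min hδ (by linarith)
  have hα' := hα.mono (Icc_subset_Icc_left (neg_le_neg (min_le_left δ (-c))))
  refine ⟨α, hα0, d, hd0, hα', fun t ht => ⟨hcα ⟨?_, ht.2⟩, ?_⟩⟩
  · linarith [ht.1, min_le_right δ (-c)]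
  · have hconst := constant_of_derivWithin_zero
      (fun s hs => (hα'.hasDerivWithinAt_bilForm hs).differentiableWithinAt)
      (fun s hs => (hα'.hasDerivWithinAt_bilForm (Ico_subset_Icc_self hs)).derivWithin
        (uniqueDiffOn_Icc (by linarith) s (Ico_subset_Icc_self hs)))
    have h1 := hconst t ht
    have h2 := hconst 0 ⟨by linarith, le_rfl⟩
    simp only [hα0] at h1 h2
    rw [h1, ← h2]
    exact h₀.2

end C1Spacetime

namespace C1Spacetime

variable {n : ℕ} {M : C1Spacetime n}

/-- A curve of non-vanishing velocity leaves its starting point immediately. -/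
lemma IsSprayCurveOn.eventually_ne {z : ℝ → SpacetimePt n × SpacetimePt n} {b : ℝ} (hb : 0 < b)
    (hz : M.IsSprayCurveOn z (Icc 0 b)) (h0 : (z 0).2 ≠ 0) :
    ∀ᶠ t in 𝓝[≥] (0 : ℝ), 0 < t → (z t).1 ≠ (z 0).1 := by
  have h1 := (hz.hasDerivWithinAt_fst ⟨le_rfl, hb.le⟩).eventually_ne h0 (c := (z 0).1)
  rw [sdiff_eq, nhdsWithin_inter', nhdsWithin_Icc_eq_nhdsGE hb, eventually_inf_principal] at h1
  filter_upwards [h1] with t ht htpos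
  exact ht htpos.ne'

/-- Local uniqueness of causal geodesics under the non-branching and non-intertwining
conditions. -/
lemma IsCausalSprayCurveOn.exists_eqOn_Icc (hnb : M.CausallyNonBranching) (hni : M.NonIntertwining)
    {z₁ z₂ : ℝ → SpacetimePt n × SpacetimePt n} {b : ℝ} (hb : 0 < b)
    (h₁ : M.IsCausalSprayCurveOn z₁ (Icc 0 b)) (h₂ : M.IsCausalSprayCurveOn z₂ (Icc 0 b))
    (h0 : z₁ 0 = z₂ 0) :
    ∃ ε ∈ Ioc 0 b, EqOn (fun t => (z₁ t).1) (fun t => (z₂ t).1) (Icc 0 ε) := by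
  have hmem0 : (0 : ℝ) ∈ Icc 0 b := ⟨le_rfl, hb.le⟩
  obtain ⟨U, hU, hUni⟩ := hni (z₁ 0).1
  have hcont : ∀ z : ℝ → SpacetimePt n × SpacetimePt n, M.IsSprayCurveOn z (Icc 0 b) →
      Tendsto (fun t => (z t).1) (𝓝[≥] 0) (𝓝 (z 0).1) := fun z hz => by
    have := (hz.hasDerivWithinAt_fst hmem0).continuousWithinAt
    rwa [ContinuousWithinAt, nhdsWithin_Icc_eq_nhdsGE hb] at this
  have hc1 := hcont z₁ h₁.1
  have hc2 := hcont z₂ h₂.1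
  rw [← h0] at hc2
  obtain ⟨ε₀, hε₀, hsub₀⟩ := mem_nhdsGE_iff_exists_Icc_subset.1
    ((hc1.eventually hU).and (hc2.eventually hU))
  set ε := min ε₀ b with hε
  have hεpos : 0 < ε := lt_min hε₀ hb
  have hεb : ε ≤ b := min_le_right _ _
  have hsub : ∀ t ∈ Icc 0 ε, (z₁ t).1 ∈ U ∧ (z₂ t).1 ∈ U := fun t ht =>
    hsub₀ ⟨ht.1, ht.2.trans (min_le_left _ _)⟩
  have hud : UniqueDiffOn ℝ (Icc 0 ε) := uniqueDiffOn_Icc hεpos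
  have h₁ε := h₁.mono (Icc_subset_Icc_right hεb)
  have h₂ε := h₂.mono (Icc_subset_Icc_right hεb)
  have hmemε : (0 : ℝ) ∈ Icc 0 ε := ⟨le_rfl, hεpos.le⟩
  rcases hUni ε hεpos _ _ (h₁ε.isCausalGeodesicOn hud) (h₂ε.isCausalGeodesicOn hud)
    (fun t ht => (hsub t ht).1) (fun t ht => (hsub t ht).2) rfl (by rw [h0])
    (by rw [h₁ε.1.derivWithin_fst hud hmemε, h₂ε.1.derivWithin_fst hud hmemε, h0])
    with heq | hacc
  · exact ⟨ε, ⟨hεpos, hεb⟩, heq⟩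
  exfalso
  have hnear := not_frequently.1 fun h => hacc ⟨(z₁ 0).1, accPt_iff_frequently.2 h⟩
  obtain ⟨η₀, hη₀, hη⟩ := mem_nhdsGE_iff_exists_Icc_subset.1
    ((hc1.eventually hnear).and (h₁.1.eventually_ne hb (h₁.2 0 hmem0).1))
  obtain ⟨α, hα0, δ, hδ, hα⟩ := exists_backward_causalSprayCurve M (z₁ 0) (h₁.2 0 hmem0)
  have hη₀' : 0 < η₀ := hη₀
  set ρ := min (min η₀ ε) δ with hρ
  have hρpos : 0 < ρ := lt_min (lt_min hη₀' hεpos) hδ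
  have hρη : ρ ≤ η₀ := (min_le_left _ _).trans (min_le_left _ _)
  have hρε : ρ ≤ ε := (min_le_left _ _).trans (min_le_right _ _)
  have hρδ : ρ ≤ δ := min_le_right _ _
  have hJ₁ := hα.1.join h₁.1 hα0 (by linarith) hb.le
  have hJ₂ := hα.1.join h₂.1 (hα0.trans h0) (by linarith) hb.le
  have hJc : M.IsCausalSprayCurveOn (fun t => if t ≤ 0 then α t else z₁ t) (Icc (-δ) b) := by
    refine ⟨hJ₁, fun t ht => ?_⟩
    by_cases h : t ≤ 0
    · simpa only [if_pos h] using hα.2 t ⟨ht.1, h⟩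
    · simpa only [if_neg h] using h₁.2 t ⟨(not_le.1 h).le, ht.2⟩
  refine hnb _ (-δ) b (by linarith) (hJc.isCausalGeodesicOn (uniqueDiffOn_Icc (by linarith))) 0
    ⟨by linarith, hb⟩ ⟨ρ, hρpos, by linarith, by linarith,
      fun t => (if t ≤ 0 then α t else z₂ t).1,
      (hJ₂.mono fun t ht => ⟨by linarith [ht.1], by linarith [ht.2]⟩).isGeodesicOn
        (uniqueDiffOn_Ioo _ _), fun t ht => ?_, ?_⟩
  · simp only [if_pos ht.2]
  · rw [eq_empty_iff_forall_notMem]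
    rintro y ⟨⟨s, hs, rfl⟩, ⟨t, ht, hst⟩⟩
    rw [zero_add] at hs ht
    simp only [if_neg hs.1.not_ge, if_neg ht.1.not_ge] at hst
    obtain ⟨hs1, hs2⟩ := hη (⟨hs.1.le, hs.2.le.trans hρη⟩ : s ∈ Icc 0 η₀)
    refine hs1 ⟨hs2 hs.1, ⟨s, ⟨hs.1, hs.2.le.trans hρε⟩, rfl⟩, ⟨t, ⟨ht.1, ht.2.le.trans hρε⟩, hst⟩⟩

/-- Global uniqueness of causal geodesics on `[0, b]` as curves in the tangent bundle. -/
lemma IsCausalSprayCurveOn.eqOn_Icc (hnb : M.CausallyNonBranching) (hni : M.NonIntertwining)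
    {z₁ z₂ : ℝ → SpacetimePt n × SpacetimePt n} {b : ℝ}
    (h₁ : M.IsCausalSprayCurveOn z₁ (Icc 0 b)) (h₂ : M.IsCausalSprayCurveOn z₂ (Icc 0 b))
    (h0 : z₁ 0 = z₂ 0) : EqOn z₁ z₂ (Icc 0 b) := by
  have hclosed : IsClosed ({t | z₁ t = z₂ t} ∩ Icc 0 b) := by
    have := (h₁.1.continuousOn.prodMk h₂.1.continuousOn).preimage_isClosed_of_isClosed
      isClosed_Icc isClosed_diagonal
    rwa [inter_comm] at this
  refine hclosed.Icc_subset_of_forall_mem_nhdsWithin h0 fun s hs => ?_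
  have hshift : ∀ z : ℝ → SpacetimePt n × SpacetimePt n, M.IsCausalSprayCurveOn z (Icc 0 b) →
      M.IsCausalSprayCurveOn (fun t => z (s + t)) (Icc 0 (b - s)) := fun z hz => by
    have hsub : ∀ t ∈ Icc 0 (b - s), s + t ∈ Icc 0 b := fun t ht =>
      ⟨by linarith [ht.1, hs.2.1], by linarith [ht.2]⟩
    exact ⟨(hz.1.comp_const_add s).mono hsub, fun t ht => hz.2 _ (hsub t ht)⟩
  have k₁ := hshift z₁ h₁
  have k₂ := hshift z₂ h₂
  obtain ⟨ε, hε, heq⟩ := k₁.exists_eqOn_Icc hnb hni (sub_pos.2 hs.2.2) k₂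
    (by simpa using hs.1)
  have hud : UniqueDiffOn ℝ (Icc 0 ε) := uniqueDiffOn_Icc hε.1
  have hsubε : Icc 0 ε ⊆ Icc 0 (b - s) := Icc_subset_Icc_right hε.2
  refine mem_of_superset (Ioc_mem_nhdsGT (show s < s + ε by linarith [hε.1])) fun t ht => ?_
  have ht' : t - s ∈ Icc 0 ε := ⟨by linarith [ht.1], by linarith [ht.2]⟩
  have hfst := heq ht'
  have hsnd := (k₁.1.mono hsubε).derivWithin_fst hud ht'
  rw [derivWithin_congr heq hfst, (k₂.1.mono hsubε).derivWithin_fst hud ht'] at hsnd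
  simp only [add_sub_cancel] at hfst hsnd
  exact Prod.ext hfst hsnd.symm

end C1Spacetime

open C1Spacetime in
/-- Lemma 4.7: in a causally non-branching, non-intertwining C¹-spacetime, causal
geodesics with the same initial position and velocity coincide on `[0,1]`. -/
theorem causal_geodesic_unique
    {n : ℕ} (hn : 2 ≤ n) (M : C1Spacetime n)
    (hnb : M.CausallyNonBranching) (hni : M.NonIntertwining)
    (γ₁ γ₂ : ℝ → SpacetimePt n) (p v : SpacetimePt n)
    (h₁ : M.IsCausalGeodesicOn γ₁ (Set.Icc 0 1))
    (h₂ : M.IsCausalGeodesicOn γ₂ (Set.Icc 0 1))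
    (h₁0 : γ₁ 0 = p) (h₂0 : γ₂ 0 = p)
    (hv₁ : derivWithin γ₁ (Set.Icc 0 1) 0 = v)
    (hv₂ : derivWithin γ₂ (Set.Icc 0 1) 0 = v) :
    ∀ t ∈ Set.Icc (0:ℝ) 1, γ₁ t = γ₂ t := by
  have hI : UniqueDiffOn ℝ (Set.Icc (0 : ℝ) 1) := uniqueDiffOn_Icc one_pos
  intro t ht
  have h := (h₁.isCausalSprayCurveOn hI).eqOn_Icc hnb hni (h₂.isCausalSprayCurveOn hI)
    (by simp only [h₁0, h₂0, hv₁, hv₂])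
  exact congrArg Prod.fst (h ht)
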